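/- Let (H, A, w) be a solution of the autonomous CSS system with the constraint on an interval containing x₀, and suppose w(x₀) < 0 and A(x₀) > 2/3. Then w′(x) < −1/2 for all x ≥ x₀ in the domain of the solution, and consequently there exists a finite x_A with x₀ < x_A ≤ x₀ + 2(1 + w(x₀)) such that lim_{x→x_A⁻} w(x) = −1 (the solution is of type A). -/

import Mathlib

open Real Filter Set Topology

noncomputable section

/-- The autonomous CSS system for `(H, A, w)` (with derivative function `H'`
for `H`) on a set `s`, together with the constraint. -/
def AutoCSS (α : ℝ) (H H' A w : ℝ → ℝ) (s : Set ℝ) : Prop :=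
  ∀ x ∈ s,
    HasDerivAt H (H' x) x ∧
    HasDerivAt H' (2 * α * w x * H' x ^ 3
        - Real.sin (2 * H x) / (A x * (w x ^ 2 - 1))) x ∧
    HasDerivAt A (-2 * α * A x * w x * H' x ^ 2) x ∧
    HasDerivAt w (-1 + α * (1 - w x ^ 2) * H' x ^ 2) x ∧
    1 - 2 * α - A x + 2 * α * Real.sin (H x) ^ 2
        + α * A x * H' x ^ 2 * (w x ^ 2 - 1) = 0

/-- A function with bounded derivative on `(a, b)` has a limit at the right endpoint. -/
lemma exists_tendsto_left_of_bounded_deriv {f f' : ℝ → ℝ} {a b M : ℝ} (hab : a < b)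
    (hf : ∀ x ∈ Ioo a b, HasDerivAt f (f' x) x) (hM : ∀ x ∈ Ioo a b, |f' x| ≤ M) :
    ∃ l, Tendsto f (𝓝[<] b) (𝓝 l) := by
  have hlip : LipschitzOnWith M.toNNReal f (Ioo a b) := by
    refine (convex_Ioo a b).lipschitzOnWith_of_nnnorm_hasDerivWithin_le
      (fun x hx => (hf x hx).hasDerivWithinAt) fun x hx => ?_
    rw [← norm_toNNReal]
    exact Real.toNNReal_le_toNNReal (hM x hx)
  obtain ⟨g, hg, hfg⟩ := hlip.extend_real
  refine ⟨g b, (hg.continuous.continuousAt.tendsto.mono_left nhdsWithin_le_nhds).congr' ?_⟩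
  filter_upwards [Ioo_mem_nhdsLT hab] with x hx using (hfg hx).symm

/-- A solution of an autonomous ODE that converges at the right end of its interval to a point
where the vector field is `C¹` extends past that end. -/
lemma exists_extension_of_tendsto {E : Type*} [NormedAddCommGroup E] [NormedSpace ℝ E]
    [CompleteSpace E] {F : E → E} {y : ℝ → E} {a b : ℝ} {p : E} (hab : a < b)
    (hy : ∀ t ∈ Ioo a b, HasDerivAt y (F (y t)) t) (hp : Tendsto y (𝓝[<] b) (𝓝 p))
    (hF : ContDiffAt ℝ 1 F p) :
    ∃ Y : ℝ → E, ∃ ε > (0 : ℝ), Y b = p ∧ EqOn Y y (Iio b) ∧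
      ∀ t ∈ Ioo a (b + ε), HasDerivAt Y (F (Y t)) t := by
  obtain ⟨z, hzb, ε, hε, hz⟩ :=
    hF.exists_forall_mem_closedBall_exists_eq_forall_mem_Ioo_hasDerivAt₀ b
  let Y : ℝ → E := fun t => if t < b then y t else z t
  have hYl : EqOn Y y (Iio b) := fun t ht => if_pos ht
  have hYr : EqOn Y z (Ici b) := fun t ht => if_neg (not_lt.2 ht)
  have hYb : Y b = p := (hYr self_mem_Ici).trans hzb
  have hleft : ∀ t ∈ Ioo a b, HasDerivAt Y (F (Y t)) t := fun t ht => by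
    rw [hYl ht.2]
    exact (hy t ht).congr_of_eventuallyEq (hYl.eventuallyEq_of_mem (Iio_mem_nhds ht.2))
  have hlim : Tendsto Y (𝓝[<] b) (𝓝 p) :=
    hp.congr' (hYl.symm.eventuallyEq_of_mem self_mem_nhdsWithin)
  refine ⟨Y, ε, hε, hYb, hYl, fun t ht => ?_⟩
  rcases lt_trichotomy t b with h | rfl | h
  · exact hleft t ⟨ht.1, h⟩
  · have hIic : HasDerivWithinAt Y (F (Y t)) (Iic t) t := by
      refine hasDerivWithinAt_Iic_of_tendsto_deriv (s := Ioo a t)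
        (fun x hx => (hleft x hx).differentiableAt.differentiableWithinAt) ?_
        (Ioo_mem_nhdsLT hab) ?_
      · rw [ContinuousWithinAt, hYb]
        exact hlim.mono_left (nhdsWithin_mono _ Ioo_subset_Iio_self)
      · rw [hYb]
        refine (hF.continuousAt.tendsto.comp hlim).congr' ?_
        filter_upwards [Ioo_mem_nhdsLT hab] with x hx using (hleft x hx).deriv.symm
    have hIci : HasDerivWithinAt Y (F (Y t)) (Ici t) t := by
      have h := (hz t ⟨by linarith, by linarith⟩).hasDerivWithinAt (s := Ici t)
      rw [hYb, ← hzb]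
      exact h.congr hYr (hYr self_mem_Ici)
    simpa [Iic_union_Ici] using hIic.union hIci
  · rw [hYr h.le]
    exact (hz t ⟨by linarith, ht.2⟩).congr_of_eventuallyEq
      (hYr.eventuallyEq_of_mem (Ici_mem_nhds h))

/-- The vector field of the autonomous CSS system in the variables `(H, H', A, w)`. -/
def cssField (α : ℝ) (y : ℝ × ℝ × ℝ × ℝ) : ℝ × ℝ × ℝ × ℝ :=
  (y.2.1,
    2 * α * y.2.2.2 * y.2.1 ^ 3 - Real.sin (2 * y.1) / (y.2.2.1 * (y.2.2.2 ^ 2 - 1)),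
    -2 * α * y.2.2.1 * y.2.2.2 * y.2.1 ^ 2,
    -1 + α * (1 - y.2.2.2 ^ 2) * y.2.1 ^ 2)

lemma contDiffAt_cssField (α : ℝ) {y : ℝ × ℝ × ℝ × ℝ} (hA : y.2.2.1 ≠ 0)
    (hw : y.2.2.2 ^ 2 - 1 ≠ 0) : ContDiffAt ℝ 1 (cssField α) y := by
  have hne : y.2.2.1 * (y.2.2.2 ^ 2 - 1) ≠ 0 := mul_ne_zero hA hw
  unfold cssField
  fun_prop (disch := assumption)

/-- The left-hand side of the constraint. -/
def cssConstraint (α : ℝ) (y : ℝ × ℝ × ℝ × ℝ) : ℝ :=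
  1 - 2 * α - y.2.2.1 + 2 * α * Real.sin y.1 ^ 2
    + α * y.2.2.1 * y.2.1 ^ 2 * (y.2.2.2 ^ 2 - 1)

lemma hasDerivAt_components {Y : ℝ → ℝ × ℝ × ℝ × ℝ} {v : ℝ × ℝ × ℝ × ℝ} {t : ℝ}
    (h : HasDerivAt Y v t) :
    HasDerivAt (fun s => (Y s).1) v.1 t ∧ HasDerivAt (fun s => (Y s).2.1) v.2.1 t ∧
      HasDerivAt (fun s => (Y s).2.2.1) v.2.2.1 t ∧
      HasDerivAt (fun s => (Y s).2.2.2) v.2.2.2 t := by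
  have h2 := (hasFDerivAt_snd (𝕜 := ℝ)).comp_hasDerivAt t h
  have h3 := (hasFDerivAt_snd (𝕜 := ℝ)).comp_hasDerivAt t h2
  have k1 := (hasFDerivAt_fst (𝕜 := ℝ)).comp_hasDerivAt t h
  have k2 := (hasFDerivAt_fst (𝕜 := ℝ)).comp_hasDerivAt t h2
  have k3 := (hasFDerivAt_fst (𝕜 := ℝ)).comp_hasDerivAt t h3
  have k4 := (hasFDerivAt_snd (𝕜 := ℝ)).comp_hasDerivAt t h3
  exact ⟨k1, k2, k3, k4⟩

/-- The constraint is a first integral of the flow. -/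
lemma hasDerivAt_cssConstraint {α t : ℝ} {Y : ℝ → ℝ × ℝ × ℝ × ℝ}
    (h : HasDerivAt Y (cssField α (Y t)) t) (hA : (Y t).2.2.1 ≠ 0)
    (hw : (Y t).2.2.2 ^ 2 - 1 ≠ 0) :
    HasDerivAt (fun s => cssConstraint α (Y s)) 0 t := by
  obtain ⟨h1, h2, h3, h4⟩ := hasDerivAt_components h
  have key := ((h3.const_sub (1 - 2 * α)).add ((h1.sin.pow 2).const_mul (2 * α))).add
    (((h3.const_mul α).mul (h2.pow 2)).mul ((h4.pow 2).sub_const 1))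
  refine key.congr_deriv ?_
  simp only [cssField, Real.sin_two_mul, Pi.pow_apply, Pi.mul_apply]
  field_simp
  push_cast
  ring

/-- A solution whose components converge, with `A ≠ 0` and `w² ≠ 1` in the limit, extends. -/
lemma AutoCSS.exists_extension {α a b h p A₀ w₀ : ℝ} {H H' A w : ℝ → ℝ} (hab : a < b)
    (hsol : AutoCSS α H H' A w (Ioo a b)) (hH : Tendsto H (𝓝[<] b) (𝓝 h))
    (hp : Tendsto H' (𝓝[<] b) (𝓝 p)) (hA : Tendsto A (𝓝[<] b) (𝓝 A₀))
    (hw : Tendsto w (𝓝[<] b) (𝓝 w₀)) (hA₀ : A₀ ≠ 0) (hw₀ : w₀ ^ 2 - 1 ≠ 0) :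
    ∃ c, b < c ∧ ∃ H₂ H₂' A₂ w₂ : ℝ → ℝ, AutoCSS α H₂ H₂' A₂ w₂ (Ioo a c) ∧
      EqOn H₂ H (Ioo a b) ∧ EqOn H₂' H' (Ioo a b) ∧ EqOn A₂ A (Ioo a b) ∧
      EqOn w₂ w (Ioo a b) := by
  obtain ⟨Y, ε, hε, hYb, hYeq, hY⟩ := exists_extension_of_tendsto (F := cssField α)
    (y := fun t => (H t, H' t, A t, w t)) hab
    (fun t ht => (hsol t ht).1.prodMk
      ((hsol t ht).2.1.prodMk ((hsol t ht).2.2.1.prodMk (hsol t ht).2.2.2.1)))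
    (hH.prodMk_nhds (hp.prodMk_nhds (hA.prodMk_nhds hw))) (contDiffAt_cssField α hA₀ hw₀)
  have hYc : ContinuousAt Y b := (hY b ⟨hab, by linarith⟩).continuousAt
  have hev : ∀ᶠ t in 𝓝 b, (Y t).2.2.1 ≠ 0 ∧ (Y t).2.2.2 ^ 2 - 1 ≠ 0 := by
    have h3 : ContinuousAt (fun t => (Y t).2.2.1) b := by fun_prop
    have h4 : ContinuousAt (fun t => (Y t).2.2.2 ^ 2 - 1) b := by fun_prop
    exact (h3.eventually_ne (by rw [hYb]; exact hA₀)).and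
      (h4.eventually_ne (by rw [hYb]; exact hw₀))
  obtain ⟨⟨l, u⟩, ⟨hlb, hbu⟩, hlu⟩ := ((nhds_basis_Ioo b).eventually_iff).1
    (hev.and (Ioo_mem_nhds hab (lt_add_of_pos_right b hε)))
  have hleft : ∀ t ∈ Ioo a b, cssConstraint α (Y t) = 0 := fun t ht => by
    rw [hYeq ht.2]
    exact (hsol t ht).2.2.2.2
  have hderiv : ∀ t ∈ Ioo l u, HasDerivAt (fun s => cssConstraint α (Y s)) 0 t := fun t ht =>
    hasDerivAt_cssConstraint (hY t (hlu ht).2) (hlu ht).1.1 (hlu ht).1.2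
  have hcon : ∀ t ∈ Ioo a u, cssConstraint α (Y t) = 0 := fun t ht => by
    rcases lt_or_ge t b with htb | htb
    · exact hleft t ⟨ht.1, htb⟩
    · obtain ⟨m, hm, hmb⟩ := exists_between (max_lt hab hlb)
      obtain ⟨ham, hlm⟩ := max_lt_iff.1 hm
      rw [← hleft m ⟨ham, hmb⟩]
      exact isOpen_Ioo.is_const_of_deriv_eq_zero isPreconnected_Ioo
        (fun s hs => (hderiv s hs).differentiableAt.differentiableWithinAt)
        (fun s hs => (hderiv s hs).deriv) ⟨hlb.trans_le htb, ht.2⟩ ⟨hlm, hmb.trans hbu⟩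
  refine ⟨min u (b + ε), lt_min hbu (by linarith), fun t => (Y t).1, fun t => (Y t).2.1,
    fun t => (Y t).2.2.1, fun t => (Y t).2.2.2, fun t ht => ?_, ?_, ?_, ?_, ?_⟩
  · obtain ⟨htu, htε⟩ := lt_min_iff.1 ht.2
    obtain ⟨h1, h2, h3, h4⟩ := hasDerivAt_components (hY t ⟨ht.1, htε⟩)
    exact ⟨h1, h2, h3, h4, hcon t ⟨ht.1, htu⟩⟩
  all_goals
    intro t ht
    simp only [hYeq ht.2]

/-- The constraint bounds `α (1 - w²) H'²` where `A > 2/3`. -/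
lemma constraint_bounds {α h p A w : ℝ} (hα0 : 0 < α) (hα : α < 1 / 2) (hw1 : -1 < w)
    (hw0 : w < 0)
    (hc : 1 - 2 * α - A + 2 * α * Real.sin h ^ 2 + α * A * p ^ 2 * (w ^ 2 - 1) = 0) :
    0 < A ∧ A ≤ 1 ∧ (2 / 3 < A → α * (1 - w ^ 2) * p ^ 2 < 1 / 2) := by
  have hu : 0 ≤ α * (1 - w ^ 2) * p ^ 2 :=
    mul_nonneg (mul_nonneg hα0.le (by nlinarith)) (sq_nonneg p)
  set u := α * (1 - w ^ 2) * p ^ 2 with hu_def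
  have hs : A * (1 + u) = 1 - 2 * α + 2 * α * Real.sin h ^ 2 := by
    rw [hu_def]; linear_combination -hc
  have hpos : 0 < A * (1 + u) := by
    rw [hs]; nlinarith [mul_nonneg hα0.le (sq_nonneg (Real.sin h))]
  have hle : A * (1 + u) ≤ 1 := by
    rw [hs]; nlinarith [mul_le_mul_of_nonneg_left (Real.sin_sq_le_one h) hα0.le]
  have hApos : 0 < A := pos_of_mul_pos_left hpos (by linarith)
  exact ⟨hApos, by nlinarith [mul_nonneg hApos.le hu], fun hA => by nlinarith⟩

/-- The region `w < 0`, `A > 2/3` is forward invariant as long as `-1 < w`. -/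
lemma AutoCSS.forward_invariant {α : ℝ} {H H' A w : ℝ → ℝ} {x₀ b : ℝ} (hα0 : 0 < α)
    (hα : α < 1 / 2) (hsol : AutoCSS α H H' A w (Ico x₀ b)) (hw0 : w x₀ < 0)
    (hA0 : 2 / 3 < A x₀) (hwgt : ∀ x ∈ Ico x₀ b, -1 < w x) :
    ∀ x ∈ Ico x₀ b, w x < 0 ∧ 2 / 3 < A x ∧ w x ≤ w x₀ - (x - x₀) / 2 := by
  have hstep : ∀ t ∈ Ico x₀ b, (∀ s ∈ Ico x₀ t, w s < 0) →
      A x₀ ≤ A t ∧ w t ≤ w x₀ - (t - x₀) / 2 := by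
    intro t ht hneg
    have hsub : Icc x₀ t ⊆ Ico x₀ b := fun s hs => ⟨hs.1, hs.2.trans_lt ht.2⟩
    have hA : MonotoneOn A (Icc x₀ t) := by
      refine monotoneOn_of_hasDerivWithinAt_nonneg (convex_Icc _ _)
        (fun s hs => (hsol s (hsub hs)).2.2.1.continuousAt.continuousWithinAt)
        (fun s hs => (hsol s (hsub (interior_subset hs))).2.2.1.hasDerivWithinAt) fun s hs => ?_
      rw [interior_Icc] at hs
      have hs' := hsub (Ioo_subset_Icc_self hs)
      have hws := hneg s ⟨hs.1.le, hs.2⟩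
      have hApos := (constraint_bounds hα0 hα (hwgt s hs') hws (hsol s hs').2.2.2.2).1
      have : 0 ≤ 2 * α * A s * (-w s) * H' s ^ 2 := by
        have := neg_pos.2 hws
        positivity
      linarith
    have hmem : x₀ ∈ Icc x₀ t := left_mem_Icc.2 ht.1
    have hmemt : t ∈ Icc x₀ t := right_mem_Icc.2 ht.1
    have hw : AntitoneOn (fun s => w s + s / 2) (Icc x₀ t) := by
      refine antitoneOn_of_hasDerivWithinAt_nonpos (convex_Icc _ _)
        (fun s hs => ((hsol s (hsub hs)).2.2.2.1.add
          ((hasDerivAt_id s).div_const 2)).continuousAt.continuousWithinAt)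
        (fun s hs => ((hsol s (hsub (interior_subset hs))).2.2.2.1.add
          ((hasDerivAt_id s).div_const 2)).hasDerivWithinAt) fun s hs => ?_
      rw [interior_Icc] at hs
      have hs' := hsub (Ioo_subset_Icc_self hs)
      have := (constraint_bounds hα0 hα (hwgt s hs') (hneg s ⟨hs.1.le, hs.2⟩)
        (hsol s hs').2.2.2.2).2.2 (hA0.trans_le (hA hmem (Ioo_subset_Icc_self hs) hs.1.le))
      linarith
    have := hw hmem hmemt ht.1
    exact ⟨hA hmem hmemt ht.1, by dsimp only at this; linarith⟩
  have hneg : ∀ x ∈ Ico x₀ b, w x < 0 := by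
    by_contra! hcon
    obtain ⟨x, hx, hwx⟩ := hcon
    have hcont : ContinuousOn w (Icc x₀ x) := fun s hs =>
      (hsol s ⟨hs.1, hs.2.trans_lt hx.2⟩).2.2.2.1.continuousAt.continuousWithinAt
    have hcomp : IsCompact (Icc x₀ x ∩ w ⁻¹' Ici 0) :=
      isCompact_Icc.of_isClosed_subset (hcont.preimage_isClosed_of_isClosed isClosed_Icc isClosed_Ici)
        inter_subset_left
    obtain ⟨t, ⟨htx, hwt⟩, hmin⟩ := hcomp.exists_isLeast ⟨x, right_mem_Icc.2 hx.1, hwx⟩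
    have h := (hstep t ⟨htx.1, htx.2.trans_lt hx.2⟩ fun s hs => by
      by_contra! hs0
      exact (hmin ⟨⟨hs.1, hs.2.le.trans htx.2⟩, hs0⟩).not_gt hs.2).2
    have h0 : 0 ≤ w t := hwt
    linarith [htx.1]
  intro x hx
  have h := hstep x hx fun s hs => hneg s ⟨hs.1, hs.2.trans hx.2⟩
  exact ⟨hneg x hx, hA0.trans_le h.1, h.2⟩

/-- If `w` stays away from `-1` in the region `w < 0`, `A > 2/3`, every component of the solution
converges at the right end. -/
lemma AutoCSS.exists_tendsto_left {α L x₀ b : ℝ} {H H' A w : ℝ → ℝ} (hα0 : 0 < α)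
    (hα : α < 1 / 2) (hab : x₀ < b) (hsol : AutoCSS α H H' A w (Ioo x₀ b)) (hL : -1 < L)
    (hLw : ∀ x ∈ Ioo x₀ b, L ≤ w x) (hw0 : ∀ x ∈ Ioo x₀ b, w x < 0)
    (hA : ∀ x ∈ Ioo x₀ b, 2 / 3 < A x) :
    (∃ h, Tendsto H (𝓝[<] b) (𝓝 h)) ∧ (∃ p, Tendsto H' (𝓝[<] b) (𝓝 p)) ∧
      ∃ a, Tendsto A (𝓝[<] b) (𝓝 a) := by
  obtain ⟨M, hM0, hM⟩ : ∃ M, 0 ≤ M ∧ ∀ x ∈ Ioo x₀ b, |H' x| ≤ M := by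
    refine ⟨1 + 1 / (2 * α * (1 + L)), ?_, fun x hx => ?_⟩
    · have : 0 < 1 + L := by linarith
      positivity
    have hu := (constraint_bounds hα0 hα (hL.trans_le (hLw x hx)) (hw0 x hx)
      (hsol x hx).2.2.2.2).2.2 (hA x hx)
    have h1 : 1 + L ≤ 1 - w x ^ 2 := by nlinarith [hLw x hx, hw0 x hx]
    have h2 : α * (1 + L) * H' x ^ 2 < 1 / 2 := lt_of_le_of_lt (by gcongr) hu
    have h3 : H' x ^ 2 ≤ 1 / (2 * α * (1 + L)) := by
      have : 0 < 1 + L := by linarith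
      rw [le_div_iff₀ (by positivity)]
      linarith
    nlinarith [sq_abs (H' x), sq_nonneg (|H' x| - 1)]
  have hw1 : ∀ x ∈ Ioo x₀ b, |w x| ≤ 1 := fun x hx =>
    abs_le.2 ⟨by linarith [hLw x hx], by linarith [hw0 x hx]⟩
  refine ⟨exists_tendsto_left_of_bounded_deriv hab (fun x hx => (hsol x hx).1) hM,
    exists_tendsto_left_of_bounded_deriv (M := 2 * α * 1 * M ^ 3 + 1 / (2 / 3 * (1 + L))) hab
      (fun x hx => (hsol x hx).2.1) fun x hx => ?_,
    exists_tendsto_left_of_bounded_deriv (M := 2 * α * 1 * 1 * M ^ 2) hab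
      (fun x hx => (hsol x hx).2.2.1) fun x hx => ?_⟩
  · have h1 : 1 + L ≤ |w x ^ 2 - 1| := by
      rw [abs_sub_comm]
      exact le_trans (by nlinarith [hLw x hx, hw0 x hx]) (le_abs_self _)
    have h2 : 2 / 3 ≤ |A x| := (hA x hx).le.trans (le_abs_self _)
    have h3 : 0 < 1 + L := by linarith
    have h4 := hw1 x hx
    have h5 := hM x hx
    refine (abs_sub _ _).trans (add_le_add ?_ ?_)
    · rw [abs_mul, abs_mul, abs_of_pos (by positivity : 0 < 2 * α), abs_pow]
      gcongr
    · rw [abs_div, abs_mul]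
      gcongr
      exact Real.abs_sin_le_one _
  · have h1 : |A x| ≤ 1 := by
      have := constraint_bounds hα0 hα (hL.trans_le (hLw x hx)) (hw0 x hx) (hsol x hx).2.2.2.2
      exact abs_le.2 ⟨by linarith, this.2.1⟩
    have h4 := hw1 x hx
    have h5 := hM x hx
    rw [abs_mul, abs_mul, abs_mul, abs_pow, neg_mul, abs_neg, abs_of_pos (by positivity : 0 < 2 * α)]
    gcongr

/-- Lemma 11: if a solution of the autonomous CSS system has `w(x₀) < 0` and
`A(x₀) > 2/3`, then `w'(x) < -1/2` for all `x ≥ x₀` in the domain; hence, for a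
maximal (non-extendable) solution, `w` reaches `-1` in the limit at some finite
`x_A = xmax ≤ x₀ + 2(1 + w(x₀))`, i.e. the solution is of type A. -/
theorem lemma11 (α : ℝ) (hα0 : 0 < α) (hα : α < 1 / 2)
    (H H' A w : ℝ → ℝ) (xlo xmax x₀ : ℝ)
    (hx₀ : x₀ ∈ Set.Ioo xlo xmax)
    (hsol : AutoCSS α H H' A w (Set.Ioo xlo xmax))
    (hw0 : w x₀ < 0) (hA0 : 2 / 3 < A x₀)
    (hwgt : ∀ x ∈ Set.Ioo xlo xmax, x₀ ≤ x → -1 < w x)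
    (hmax : ∀ b, xmax < b → ¬ ∃ H₂ H₂' A₂ w₂ : ℝ → ℝ,
        AutoCSS α H₂ H₂' A₂ w₂ (Set.Ioo xlo b) ∧
        Set.EqOn H₂ H (Set.Ioo xlo xmax) ∧ Set.EqOn H₂' H' (Set.Ioo xlo xmax) ∧
        Set.EqOn A₂ A (Set.Ioo xlo xmax) ∧ Set.EqOn w₂ w (Set.Ioo xlo xmax)) :
    (∀ x ∈ Set.Ioo xlo xmax, x₀ ≤ x →
        -1 + α * (1 - w x ^ 2) * H' x ^ 2 < -1 / 2) ∧
    x₀ < xmax ∧ xmax ≤ x₀ + 2 * (1 + w x₀) ∧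
    Tendsto w (𝓝[<] xmax) (𝓝 (-1)) := by
  have hsub : Ico x₀ xmax ⊆ Ioo xlo xmax := fun x hx => ⟨hx₀.1.trans_le hx.1, hx.2⟩
  have hgt : ∀ x ∈ Ico x₀ xmax, -1 < w x := fun x hx => hwgt x (hsub hx) hx.1
  have hinv := AutoCSS.forward_invariant hα0 hα (fun x hx => hsol x (hsub hx)) hw0 hA0 hgt
  have hu : ∀ x ∈ Ico x₀ xmax, -1 + α * (1 - w x ^ 2) * H' x ^ 2 < -1 / 2 := fun x hx => by
    linarith [(constraint_bounds hα0 hα (hgt x hx) (hinv x hx).1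
      (hsol x (hsub hx)).2.2.2.2).2.2 (hinv x hx).2.1]
  have hanti : AntitoneOn w (Ico x₀ xmax) := by
    refine antitoneOn_of_hasDerivWithinAt_nonpos (convex_Ico _ _)
      (fun s hs => (hsol s (hsub hs)).2.2.2.1.continuousAt.continuousWithinAt)
      (fun s hs => (hsol s (hsub (interior_subset hs))).2.2.2.1.hasDerivWithinAt) fun s hs => ?_
    linarith [hu s (interior_subset hs)]
  refine ⟨fun x hx hxx => hu x ⟨hxx, hx.2⟩, hx₀.2, ?_, ?_⟩
  · refine le_of_forall_lt_imp_le_of_dense fun x hx => ?_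
    rcases le_or_gt x₀ x with h | h
    · linarith [hgt x ⟨h, hx⟩, (hinv x ⟨h, hx⟩).2.2]
    · linarith [hgt x₀ ⟨le_rfl, hx₀.2⟩]
  · have hsub' : Ioo x₀ xmax ⊆ Ico x₀ xmax := Ioo_subset_Ico_self
    obtain ⟨L, hL⟩ : ∃ L, Tendsto w (𝓝[<] xmax) (𝓝 L) := by
      refine exists_tendsto_left_of_bounded_deriv (M := 1) hx₀.2
        (fun x hx => (hsol x (hsub (hsub' hx))).2.2.2.1) fun x hx => ?_
      have hw := hgt x (hsub' hx)
      have hw' := (hinv x (hsub' hx)).1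
      have : 0 ≤ α * (1 - w x ^ 2) * H' x ^ 2 :=
        mul_nonneg (mul_nonneg hα0.le (by nlinarith)) (sq_nonneg _)
      exact abs_le.2 ⟨by linarith, by linarith [hu x (hsub' hx)]⟩
    have hnhds : Ioo x₀ xmax ∈ 𝓝[<] xmax := Ioo_mem_nhdsLT hx₀.2
    have hL1 : -1 ≤ L := ge_of_tendsto hL
      (Filter.mem_of_superset hnhds fun x hx => (hgt x (hsub' hx)).le)
    rcases hL1.eq_or_lt with rfl | hL1
    · exact hL
    have hLw : ∀ x ∈ Ioo x₀ xmax, L ≤ w x := fun x hx => by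
      refine le_of_tendsto hL ?_
      filter_upwards [Ioo_mem_nhdsLT hx.2] with y hy
      exact hanti (hsub' hx) ⟨hx.1.le.trans hy.1.le, hy.2⟩ hy.1.le
    obtain ⟨⟨h, hh⟩, ⟨p, hp⟩, a, ha⟩ := AutoCSS.exists_tendsto_left hα0 hα hx₀.2
      (fun x hx => hsol x (hsub (hsub' hx))) hL1 hLw (fun x hx => (hinv x (hsub' hx)).1)
      fun x hx => (hinv x (hsub' hx)).2.1
    have ha0 : 2 / 3 ≤ a := ge_of_tendsto ha
      (Filter.mem_of_superset hnhds fun x hx => (hinv x (hsub' hx)).2.1.le)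
    have hL0 : L < 0 := by
      obtain ⟨x, hx⟩ := exists_between hx₀.2
      exact (hLw x hx).trans_lt (hinv x (hsub' hx)).1
    obtain ⟨c, hc, hext⟩ := AutoCSS.exists_extension (hx₀.1.trans hx₀.2) hsol hh hp ha hL
      (by linarith) (by nlinarith)
    exact absurd hext (hmax c hc)
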